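/- Let n, k ≥ 1, ℓ ∈ {0, …, k−1} with n > 2(k−ℓ), and let A(D) be a homogeneous linear differential operator of order k on ℝⁿ from V to E which is injectively elliptic. Then there exists a constant C ∈ (0,∞) such that for every u ∈ C^∞_c(ℝⁿ, V) one has (∫_{ℝⁿ} |D^ℓ u|^{2n/(n−2(k−ℓ))})^{1 − 2(k−ℓ)/n} ≤ C ∫_{ℝⁿ} |A(D)u|². -/

import Mathlib

open MeasureTheory

noncomputable section

/-- First-order partial derivative in the `i`-th coordinate direction. -/
def pd {n : ℕ} {V : Type*} [NormedAddCommGroup V] [NormedSpace ℝ V] (i : Fin n)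
    (u : EuclideanSpace ℝ (Fin n) → V) : EuclideanSpace ℝ (Fin n) → V :=
  fun x => fderiv ℝ u x (EuclideanSpace.single i 1)

/-- Iterated partial derivative `∂^α`. -/
def pdMulti {n : ℕ} {V : Type*} [NormedAddCommGroup V] [NormedSpace ℝ V] (α : Fin n → ℕ)
    (u : EuclideanSpace ℝ (Fin n) → V) : EuclideanSpace ℝ (Fin n) → V :=
  (List.finRange n).foldr (fun i v => (pd i)^[α i] v) u

/-- The homogeneous differential operator `A(D) = ∑_{|α|=k} A_α ∂^α` applied to `u`. -/
def opApply {n : ℕ} {V E : Type*} [NormedAddCommGroup V] [NormedSpace ℝ V]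
    [NormedAddCommGroup E] [NormedSpace ℝ E]
    (k : ℕ) (A : (Fin n → ℕ) → (V →ₗ[ℝ] E))
    (u : EuclideanSpace ℝ (Fin n) → V) : EuclideanSpace ℝ (Fin n) → E :=
  fun x => ∑ α ∈ Finset.Nat.antidiagonalTuple n k, A α (pdMulti α u x)

/-- The symbol `A(ξ) = ∑_{|α|=k} ξ^α A_α` of the operator. -/
def symb {n : ℕ} {V E : Type*} [NormedAddCommGroup V] [NormedSpace ℝ V]
    [NormedAddCommGroup E] [NormedSpace ℝ E]
    (k : ℕ) (A : (Fin n → ℕ) → (V →ₗ[ℝ] E)) (ξ : EuclideanSpace ℝ (Fin n)) :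
    V →ₗ[ℝ] E :=
  ∑ α ∈ Finset.Nat.antidiagonalTuple n k, (∏ i, ξ i ^ α i) • A α

open scoped LineDeriv FourierTransform SchwartzMap

/-- Schwartz version of the iterated partial derivatives. -/
def pdS {n : ℕ} {F : Type*} [NormedAddCommGroup F] [NormedSpace ℝ F] (α : Fin n → ℕ)
    (l : List (Fin n)) (f : 𝓢(EuclideanSpace ℝ (Fin n), F)) : 𝓢(EuclideanSpace ℝ (Fin n), F) :=
  l.foldr (fun i v => (fun g : 𝓢(EuclideanSpace ℝ (Fin n), F) =>
    ∂_{EuclideanSpace.single i (1 : ℝ)} g)^[α i] v) f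

lemma pd_iter_coe {n : ℕ} {F : Type*} [NormedAddCommGroup F] [NormedSpace ℝ F] (i : Fin n) (m : ℕ)
    (f : 𝓢(EuclideanSpace ℝ (Fin n), F)) :
    ⇑((fun g : 𝓢(EuclideanSpace ℝ (Fin n), F) =>
      ∂_{EuclideanSpace.single i (1 : ℝ)} g)^[m] f) = (pd i)^[m] ⇑f := by
  induction m with
  | zero => rfl
  | succ m ih =>
    rw [Function.iterate_succ_apply', Function.iterate_succ_apply', ← ih]
    rfl

lemma pdS_coe {n : ℕ} {F : Type*} [NormedAddCommGroup F] [NormedSpace ℝ F] (α : Fin n → ℕ)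
    (f : 𝓢(EuclideanSpace ℝ (Fin n), F)) :
    ⇑(pdS α (List.finRange n) f) = pdMulti α ⇑f := by
  unfold pdS pdMulti
  induction (List.finRange n) with
  | nil => rfl
  | cons i l ih =>
    simp only [List.foldr_cons]
    rw [pd_iter_coe, ih]

lemma lineDeriv_postcomp {n : ℕ} {F G : Type*} [NormedAddCommGroup F] [NormedSpace ℝ F]
    [NormedAddCommGroup G] [NormedSpace ℝ G] (L : F →L[ℝ] G)
    (f : 𝓢(EuclideanSpace ℝ (Fin n), F)) (m : EuclideanSpace ℝ (Fin n)) :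
    ∂_{m} (f.postcompCLM L) = (∂_{m} f).postcompCLM L := by
  ext x
  rw [SchwartzMap.postcompCLM_apply, SchwartzMap.lineDerivOp_apply_eq_fderiv,
    SchwartzMap.lineDerivOp_apply_eq_fderiv]
  have : ⇑(f.postcompCLM L) = L ∘ f := rfl
  rw [this, fderiv_comp x L.differentiableAt f.differentiableAt, L.fderiv]
  rfl

lemma pdS_postcomp {n : ℕ} {F G : Type*} [NormedAddCommGroup F] [NormedSpace ℝ F]
    [NormedAddCommGroup G] [NormedSpace ℝ G] (L : F →L[ℝ] G) (α : Fin n → ℕ) (l : List (Fin n))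
    (f : 𝓢(EuclideanSpace ℝ (Fin n), F)) :
    pdS α l (f.postcompCLM L) = (pdS α l f).postcompCLM L := by
  unfold pdS
  induction l with
  | nil => rfl
  | cons i l ih =>
    simp only [List.foldr_cons]
    rw [ih]
    generalize List.foldr _ f l = g
    induction α i with
    | zero => rfl
    | succ m ih2 =>
      rw [Function.iterate_succ_apply', Function.iterate_succ_apply', ih2, lineDeriv_postcomp]

lemma iter_postcomp {n k : ℕ} {F G : Type*} [NormedAddCommGroup F] [NormedSpace ℝ F]
    [NormedAddCommGroup G] [NormedSpace ℝ G] (L : F →L[ℝ] G)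
    (m : Fin k → EuclideanSpace ℝ (Fin n))
    (f : 𝓢(EuclideanSpace ℝ (Fin n), F)) :
    ∂^{m} (f.postcompCLM L) = (∂^{m} f).postcompCLM L := by
  induction k with
  | zero => rfl
  | succ k ih =>
    rw [LineDeriv.iteratedLineDerivOp_succ_left, LineDeriv.iteratedLineDerivOp_succ_left, ih,
      lineDeriv_postcomp]

lemma fourier_lineDeriv {n : ℕ} (f : 𝓢(EuclideanSpace ℝ (Fin n), ℂ)) (i : Fin n)
    (ξ : EuclideanSpace ℝ (Fin n)) :
    𝓕 (∂_{EuclideanSpace.single i (1 : ℝ)} f) ξ = (2 * Real.pi * Complex.I) * (ξ i : ℂ) * 𝓕 f ξ := by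
  rw [SchwartzMap.fourier_lineDerivOp_eq, smul_apply,
    SchwartzMap.smulLeftCLM_apply_apply (by fun_prop)]
  simp [EuclideanSpace.inner_single_right, mul_assoc]

lemma fourier_iter {n k : ℕ} (f : 𝓢(EuclideanSpace ℝ (Fin n), ℂ)) (σ : Fin k → Fin n)
    (ξ : EuclideanSpace ℝ (Fin n)) :
    𝓕 (∂^{fun j => EuclideanSpace.single (σ j) (1 : ℝ)} f) ξ =
      (2 * Real.pi * Complex.I) ^ k * ((∏ j, ξ (σ j) : ℝ) : ℂ) * 𝓕 f ξ := by
  induction k with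
  | zero => simp
  | succ k ih =>
    rw [LineDeriv.iteratedLineDerivOp_succ_left, fourier_lineDeriv]
    have := ih (Fin.tail σ)
    unfold Fin.tail at *
    rw [this, Fin.prod_univ_succ]
    push_cast
    ring

lemma fourier_pdS {n : ℕ} (f : 𝓢(EuclideanSpace ℝ (Fin n), ℂ)) (α : Fin n → ℕ)
    (ξ : EuclideanSpace ℝ (Fin n)) :
    𝓕 (pdS α (List.finRange n) f) ξ =
      (2 * Real.pi * Complex.I) ^ (∑ i, α i) * ((∏ i, ξ i ^ α i : ℝ) : ℂ) * 𝓕 f ξ := by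
  have key : ∀ l : List (Fin n), 𝓕 (pdS α l f) ξ =
      (l.map fun i => ((2 * Real.pi * Complex.I) * (ξ i : ℂ)) ^ α i).prod * 𝓕 f ξ := by
    intro l
    unfold pdS
    induction l with
    | nil => simp
    | cons i l ih =>
      simp only [List.foldr_cons, List.map_cons, List.prod_cons]
      rw [mul_assoc, ← ih]
      generalize List.foldr _ f l = g
      induction α i with
      | zero => simp
      | succ m ih2 =>
        rw [Function.iterate_succ_apply', fourier_lineDeriv, ih2]
        ring
  rw [key, ← List.ofFn_eq_map, List.prod_ofFn]
  simp only [mul_pow, Finset.prod_mul_distrib, Finset.prod_pow_eq_pow_sum]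
  push_cast
  rfl

/-- complexified coordinate functional -/
def cf {V : Type*} [NormedAddCommGroup V] [NormedSpace ℝ V] (φ : V →L[ℝ] ℝ) : V →L[ℝ] ℂ :=
  Complex.ofRealCLM.comp φ

lemma exists_ab {n : ℕ} {V : Type*} [NormedAddCommGroup V] [InnerProductSpace ℝ V]
    [FiniteDimensional ℝ V] (U : 𝓢(EuclideanSpace ℝ (Fin n), V)) :
    ∃ a b : EuclideanSpace ℝ (Fin n) → V, ∀ (φ : V →L[ℝ] ℝ) ξ,
      𝓕 (U.postcompCLM (cf φ)) ξ = (φ (a ξ) : ℂ) + (φ (b ξ) : ℂ) * Complex.I := by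
  let B := stdOrthonormalBasis ℝ V
  let w : Fin (Module.finrank ℝ V) → 𝓢(EuclideanSpace ℝ (Fin n), ℂ) :=
    fun j => U.postcompCLM (cf (innerSL ℝ (B j)))
  refine ⟨fun ξ => ∑ j, (𝓕 (w j) ξ).re • B j, fun ξ => ∑ j, (𝓕 (w j) ξ).im • B j, ?_⟩
  intro φ ξ
  have h : U.postcompCLM (cf φ) = ∑ j, (φ (B j) : ℂ) • w j := by
    ext x
    rw [SchwartzMap.postcompCLM_apply, sum_apply]
    have : U x = ∑ j, inner ℝ (B j) (U x) • B j := (B.sum_repr' _).symm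
    conv_lhs => rw [this]
    simp only [w, smul_apply, SchwartzMap.postcompCLM_apply, cf]
    simp [mul_comm]
  rw [h]
  have h2 : 𝓕 (∑ j, (φ (B j) : ℂ) • w j) = ∑ j, (φ (B j) : ℂ) • 𝓕 (w j) := by
    simp
  rw [h2, sum_apply]
  simp only [smul_apply, map_sum, map_smul, smul_eq_mul]
  push_cast
  rw [Finset.sum_mul, ← Finset.sum_add_distrib]
  refine Finset.sum_congr rfl fun j _ => ?_
  conv_lhs => rw [← Complex.re_add_im (𝓕 (w j) ξ)]
  ring

lemma plancherel_le {n : ℕ} {ι : Type*} [Fintype ι] (h : 𝓢(EuclideanSpace ℝ (Fin n), ℂ))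
    (g : ι → 𝓢(EuclideanSpace ℝ (Fin n), ℂ)) (M : ℝ)
    (hM : ∀ ξ, ‖𝓕 h ξ‖ ^ 2 ≤ M * ∑ i, ‖𝓕 (g i) ξ‖ ^ 2) :
    ∫ x, ‖h x‖ ^ 2 ≤ M * ∑ i, ∫ x, ‖g i x‖ ^ 2 := by
  have I : ∀ f : 𝓢(EuclideanSpace ℝ (Fin n), ℂ), Integrable (fun x => ‖f x‖ ^ 2) := fun f =>
    (f.memLp 2).integrable_norm_pow (by norm_num)
  rw [← SchwartzMap.integral_norm_sq_fourier h,
    Finset.sum_congr rfl fun i _ => (SchwartzMap.integral_norm_sq_fourier (g i)).symm,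
    ← integral_finsetSum _ (fun i _ => I _), ← integral_const_mul]
  exact integral_mono (I _) ((integrable_finsetSum _ fun i _ => I _).const_mul _) hM

lemma symb_bound {n : ℕ} {V E : Type*} [NormedAddCommGroup V] [InnerProductSpace ℝ V]
    [FiniteDimensional ℝ V] [NormedAddCommGroup E] [InnerProductSpace ℝ E]
    (k : ℕ) (hk : 1 ≤ k) (A : (Fin n → ℕ) → (V →ₗ[ℝ] E))
    (hell : ∀ ξ : EuclideanSpace ℝ (Fin n), ξ ≠ 0 → Function.Injective (symb k A ξ)) :
    ∃ c : ℝ, 0 < c ∧ ∀ ξ v, c * ‖ξ‖ ^ k * ‖v‖ ≤ ‖symb k A ξ v‖ := by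
  have hc : Continuous fun p : EuclideanSpace ℝ (Fin n) × V => ‖symb k A p.1 p.2‖ := by
    simp only [symb, LinearMap.sum_apply, LinearMap.smul_apply]
    refine continuous_norm.comp (continuous_finsetSum _ fun α _ => ?_)
    refine Continuous.smul (by fun_prop) ?_
    exact (A α).continuous_of_finiteDimensional.comp continuous_snd
  obtain ⟨c, hc0, hcb⟩ := ((isCompact_sphere (0 : EuclideanSpace ℝ (Fin n)) 1).prod
    (isCompact_sphere (0 : V) 1)).exists_forall_le' hc.continuousOn (a := 0) (by
      rintro ⟨ξ, v⟩ ⟨h1, h2⟩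
      simp only [mem_sphere_iff_norm, sub_zero] at h1 h2
      have hξ : ξ ≠ 0 := by rintro rfl; simp at h1
      have hv : v ≠ 0 := by rintro rfl; simp at h2
      rw [norm_pos_iff]
      intro h
      exact hv (hell ξ hξ (by simpa using h)))
  have hom : ∀ (t : ℝ) ξ, symb k A (t • ξ) = t ^ k • symb k A ξ := by
    intro t ξ
    simp only [symb, Finset.smul_sum, smul_smul]
    refine Finset.sum_congr rfl fun α hα => ?_
    rw [Finset.Nat.mem_antidiagonalTuple] at hα
    simp only [PiLp.smul_apply, smul_eq_mul, mul_pow, Finset.prod_mul_distrib,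
      Finset.prod_pow_eq_pow_sum, hα]
  refine ⟨c, hc0, fun ξ v => ?_⟩
  rcases eq_or_ne v 0 with rfl | hv
  · simp
  rcases eq_or_ne ξ 0 with rfl | hξ
  · have hk0 : k ≠ 0 := by omega
    rw [norm_zero, zero_pow hk0]
    simp
  · have h1 := hcb (‖ξ‖⁻¹ • ξ, ‖v‖⁻¹ • v) (by
      constructor
      · simp [norm_smul, hξ]
      · simp [norm_smul, hv])
    simp only [hom, map_smul, norm_smul, norm_inv, norm_norm, LinearMap.smul_apply, norm_pow] at h1
    have p1 := norm_pos_iff.2 hv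
    have p2 := norm_pos_iff.2 hξ
    have : ‖symb k A ξ v‖ = ‖ξ‖ ^ k * ‖v‖ * (‖v‖⁻¹ * (‖ξ‖⁻¹ ^ k * ‖symb k A ξ v‖)) := by
      rw [inv_pow]
      field_simp
    rw [this]
    have := mul_le_mul_of_nonneg_left h1 (by positivity : 0 ≤ ‖ξ‖ ^ k * ‖v‖)
    linarith

lemma norm_cml_le {n k : ℕ} {V : Type*} [NormedAddCommGroup V] [NormedSpace ℝ V]
    (D : ContinuousMultilinearMap ℝ (fun _ : Fin k => EuclideanSpace ℝ (Fin n)) V) :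
    ‖D‖ ≤ ∑ σ : Fin k → Fin n, ‖D fun j => EuclideanSpace.single (σ j) (1 : ℝ)‖ := by
  refine D.opNorm_le_bound (Finset.sum_nonneg fun _ _ => norm_nonneg _) fun m => ?_
  have hm : m = fun j => ∑ i, m j i • EuclideanSpace.single i (1 : ℝ) := by
    funext j
    ext i
    simp [Finset.sum_apply, Pi.single_apply]
  conv_lhs => rw [hm]
  rw [D.map_sum, Finset.sum_mul]
  refine (norm_sum_le _ _).trans (Finset.sum_le_sum fun σ _ => ?_)
  rw [D.map_smul_univ, norm_smul, mul_comm, norm_prod]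
  gcongr with j
  exact PiLp.norm_apply_le _ _

lemma fourier_op {n k : ℕ} {V E : Type*} [NormedAddCommGroup V] [InnerProductSpace ℝ V]
    [FiniteDimensional ℝ V] [NormedAddCommGroup E] [InnerProductSpace ℝ E]
    (A : (Fin n → ℕ) → (V →ₗ[ℝ] E)) (U : 𝓢(EuclideanSpace ℝ (Fin n), V))
    (a b : EuclideanSpace ℝ (Fin n) → V) (hab : ∀ (φ : V →L[ℝ] ℝ) ξ,
      𝓕 (U.postcompCLM (cf φ)) ξ = (φ (a ξ) : ℂ) + (φ (b ξ) : ℂ) * Complex.I)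
    (ψ : E →L[ℝ] ℝ) :
    ∃ g : 𝓢(EuclideanSpace ℝ (Fin n), ℂ), (∀ x, g x = (ψ (opApply k A U x) : ℂ)) ∧
      ∀ ξ, 𝓕 g ξ = (2 * Real.pi * Complex.I) ^ k *
        ((ψ (symb k A ξ (a ξ)) : ℂ) + (ψ (symb k A ξ (b ξ)) : ℂ) * Complex.I) := by
  let φ : (Fin n → ℕ) → (V →L[ℝ] ℝ) := fun α => ψ.comp (A α).toContinuousLinearMap
  refine ⟨∑ α ∈ Finset.Nat.antidiagonalTuple n k,
    pdS α (List.finRange n) (U.postcompCLM (cf (φ α))), fun x => ?_, fun ξ => ?_⟩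
  · rw [sum_apply]
    simp only [opApply, map_sum, Complex.ofReal_sum]
    refine Finset.sum_congr rfl fun α _ => ?_
    rw [pdS_postcomp, SchwartzMap.postcompCLM_apply, pdS_coe]
    rfl
  · have h2 : 𝓕 (∑ α ∈ Finset.Nat.antidiagonalTuple n k,
        pdS α (List.finRange n) (U.postcompCLM (cf (φ α)))) =
        ∑ α ∈ Finset.Nat.antidiagonalTuple n k,
        𝓕 (pdS α (List.finRange n) (U.postcompCLM (cf (φ α)))) := by
      simp
    rw [h2, sum_apply]
    simp only [symb, LinearMap.sum_apply, map_sum, Complex.ofReal_sum, LinearMap.smul_apply]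
    rw [Finset.sum_mul, ← Finset.sum_add_distrib, Finset.mul_sum]
    refine Finset.sum_congr rfl fun α hα => ?_
    rw [Finset.Nat.mem_antidiagonalTuple] at hα
    rw [fourier_pdS, hα, hab]
    simp only [map_smul, smul_eq_mul, Complex.ofReal_mul, φ, ContinuousLinearMap.comp_apply,
      LinearMap.coe_toContinuousLinearMap']
    ring

lemma normSq_aux (k : ℕ) (x y : ℝ) :
    ‖(2 * Real.pi * Complex.I) ^ k * ((x : ℂ) + (y : ℂ) * Complex.I)‖ ^ 2 =
      ((2 * Real.pi) ^ k) ^ 2 * (x ^ 2 + y ^ 2) := by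
  rw [norm_mul, mul_pow, norm_pow]
  congr 1
  · simp [abs_of_pos Real.pi_pos]
  · rw [← Complex.normSq_eq_norm_sq, Complex.normSq_add_mul_I]

lemma L2_bound {n k : ℕ} {V E : Type*} [NormedAddCommGroup V] [InnerProductSpace ℝ V]
    [FiniteDimensional ℝ V] [NormedAddCommGroup E] [InnerProductSpace ℝ E] [FiniteDimensional ℝ E]
    (hk : 1 ≤ k) (A : (Fin n → ℕ) → (V →ₗ[ℝ] E))
    (hell : ∀ ξ : EuclideanSpace ℝ (Fin n), ξ ≠ 0 → Function.Injective (symb k A ξ)) :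
    ∃ C : ℝ, 0 < C ∧ ∀ U : 𝓢(EuclideanSpace ℝ (Fin n), V),
      ∫ x, ‖iteratedFDeriv ℝ k U x‖ ^ 2 ≤ C * ∫ x, ‖opApply k A U x‖ ^ 2 := by
  obtain ⟨c, hc, hcb⟩ := symb_bound k hk A hell
  let BV := stdOrthonormalBasis ℝ V
  let BE := stdOrthonormalBasis ℝ E
  let N : ℝ := (Fintype.card (Fin k → Fin n) : ℝ)
  let d : ℝ := (Fintype.card (Fin (Module.finrank ℝ V)) : ℝ)
  refine ⟨N * (N * (d * (c ^ 2)⁻¹)) + 1, by positivity, fun U => ?_⟩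
  obtain ⟨a, b, hab⟩ := exists_ab U
  choose g hg hgF using fun i => fourier_op (k := k) A U a b hab (innerSL ℝ (BE i))
  have I : ∀ f : 𝓢(EuclideanSpace ℝ (Fin n), ℂ), Integrable (fun x => ‖f x‖ ^ 2) := fun f =>
    (f.memLp 2).integrable_norm_pow (by norm_num)
  have hE : ∀ x, ‖opApply k A U x‖ ^ 2 = ∑ i, ‖g i x‖ ^ 2 := by
    intro x
    rw [← BE.sum_sq_norm_inner_right]
    refine Finset.sum_congr rfl fun i _ => ?_
    rw [hg, Complex.norm_real]
    rfl
  have hEint : ∫ x, ‖opApply k A U x‖ ^ 2 = ∑ i, ∫ x, ‖g i x‖ ^ 2 := by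
    simp only [hE]
    exact integral_finsetSum _ fun i _ => I _
  let h : (Fin k → Fin n) → Fin (Module.finrank ℝ V) → 𝓢(EuclideanSpace ℝ (Fin n), ℂ) :=
    fun σ j => ∂^{fun l => EuclideanSpace.single (σ l) (1 : ℝ)}
      (U.postcompCLM (cf (innerSL ℝ (BV j))))
  have hV : ∀ σ x, ‖iteratedFDeriv ℝ k U x fun l => EuclideanSpace.single (σ l) (1 : ℝ)‖ ^ 2
      = ∑ j, ‖h σ j x‖ ^ 2 := by
    intro σ x
    rw [← BV.sum_sq_norm_inner_right]
    refine Finset.sum_congr rfl fun j _ => ?_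
    simp only [h]
    rw [iter_postcomp, SchwartzMap.postcompCLM_apply,
      SchwartzMap.iteratedLineDerivOp_eq_iteratedFDeriv]
    simp [cf]
  have hD : ∀ x, ‖iteratedFDeriv ℝ k U x‖ ^ 2 ≤ N * ∑ σ, ∑ j, ‖h σ j x‖ ^ 2 := by
    intro x
    calc ‖iteratedFDeriv ℝ k U x‖ ^ 2
        ≤ (∑ σ : Fin k → Fin n,
          ‖iteratedFDeriv ℝ k U x fun l => EuclideanSpace.single (σ l) (1 : ℝ)‖) ^ 2 := by
          gcongr
          exact norm_cml_le _
      _ ≤ N * ∑ σ : Fin k → Fin n,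
          ‖iteratedFDeriv ℝ k U x fun l => EuclideanSpace.single (σ l) (1 : ℝ)‖ ^ 2 :=
          sq_sum_le_card_mul_sum_sq
      _ = _ := by simp only [hV]
  have hP : ∀ σ j, ∫ x, ‖h σ j x‖ ^ 2 ≤ (c ^ 2)⁻¹ * ∑ i, ∫ x, ‖g i x‖ ^ 2 := by
    intro σ j
    refine plancherel_le _ _ _ fun ξ => ?_
    have e1 : ∑ i, ‖𝓕 (g i) ξ‖ ^ 2 = ((2 * Real.pi) ^ k) ^ 2 *
        (‖symb k A ξ (a ξ)‖ ^ 2 + ‖symb k A ξ (b ξ)‖ ^ 2) := by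
      simp only [hgF, normSq_aux]
      rw [← Finset.mul_sum, Finset.sum_add_distrib, ← BE.sum_sq_norm_inner_right,
        ← BE.sum_sq_norm_inner_right]
      simp
    have e2 : ‖𝓕 (h σ j) ξ‖ ^ 2 = ((2 * Real.pi) ^ k) ^ 2 * ((∏ l, ξ (σ l)) ^ 2 *
        ((inner ℝ (BV j) (a ξ)) ^ 2 + (inner ℝ (BV j) (b ξ)) ^ 2)) := by
      have : 𝓕 (h σ j) ξ = (2 * Real.pi * Complex.I) ^ k *
          ((((∏ l, ξ (σ l)) * inner ℝ (BV j) (a ξ) : ℝ) : ℂ) +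
            (((∏ l, ξ (σ l)) * inner ℝ (BV j) (b ξ) : ℝ) : ℂ) * Complex.I) := by
        simp only [h]
        rw [fourier_iter, hab]
        simp only [innerSL_apply_apply]
        push_cast
        ring
      rw [this, normSq_aux]
      ring
    have e3 : (∏ l, ξ (σ l)) ^ 2 ≤ (‖ξ‖ ^ k) ^ 2 := by
      rw [sq_le_sq, abs_of_nonneg (by positivity : 0 ≤ ‖ξ‖ ^ k), Finset.abs_prod]
      calc ∏ l, |ξ (σ l)| ≤ ∏ _l : Fin k, ‖ξ‖ :=
            Finset.prod_le_prod (fun _ _ => abs_nonneg _) fun l _ => PiLp.norm_apply_le ξ (σ l)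
        _ = ‖ξ‖ ^ k := by simp
    have e4 : ∀ v : V, (‖ξ‖ ^ k) ^ 2 * (inner ℝ (BV j) v) ^ 2 ≤
        (c ^ 2)⁻¹ * ‖symb k A ξ v‖ ^ 2 := by
      intro v
      have h1 : (inner ℝ (BV j) v) ^ 2 ≤ ‖v‖ ^ 2 := by
        rw [sq_le_sq, abs_norm]
        simpa using abs_real_inner_le_norm (BV j) v
      have h2 : (c * ‖ξ‖ ^ k * ‖v‖) ^ 2 ≤ ‖symb k A ξ v‖ ^ 2 := by
        gcongr
        exact hcb ξ v
      rw [inv_mul_eq_div, le_div_iff₀ (by positivity)]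
      have := mul_le_mul_of_nonneg_left h1 (by positivity : 0 ≤ (c * ‖ξ‖ ^ k) ^ 2)
      nlinarith
    rw [e1, e2, mul_left_comm (c ^ 2)⁻¹]
    refine mul_le_mul_of_nonneg_left ?_ (sq_nonneg ((2 * Real.pi) ^ k))
    calc _ ≤ (‖ξ‖ ^ k) ^ 2 * ((inner ℝ (BV j) (a ξ)) ^ 2 + (inner ℝ (BV j) (b ξ)) ^ 2) := by
          gcongr
      _ ≤ _ := by rw [mul_add, mul_add]; exact add_le_add (e4 _) (e4 _)
  have h0 : 0 ≤ ∫ x, ‖opApply k A U x‖ ^ 2 := integral_nonneg fun x => by positivity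
  calc ∫ x, ‖iteratedFDeriv ℝ k U x‖ ^ 2
      ≤ ∫ x, N * ∑ σ, ∑ j, ‖h σ j x‖ ^ 2 := by
        refine integral_mono_of_nonneg (Filter.Eventually.of_forall fun x =>
          sq_nonneg ‖iteratedFDeriv ℝ k U x‖) ?_ (Filter.Eventually.of_forall hD)
        exact (integrable_finsetSum _ fun σ _ =>
          integrable_finsetSum _ fun j _ => I _).const_mul _
    _ = N * ∑ σ, ∑ j, ∫ x, ‖h σ j x‖ ^ 2 := by
        rw [integral_const_mul, integral_finsetSum _ fun σ _ =>
          integrable_finsetSum _ fun j _ => I _]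
        congr 1
        exact Finset.sum_congr rfl fun σ _ => integral_finsetSum _ fun j _ => I _
    _ ≤ N * ∑ _σ : Fin k → Fin n, ∑ _j : Fin (Module.finrank ℝ V),
          (c ^ 2)⁻¹ * ∑ i, ∫ x, ‖g i x‖ ^ 2 := by
        gcongr with σ _ j _
        exact hP σ j
    _ = (N * (N * (d * (c ^ 2)⁻¹))) * ∫ x, ‖opApply k A U x‖ ^ 2 := by
        rw [hEint, Finset.sum_const, Finset.sum_const]
        simp only [nsmul_eq_mul, Finset.card_univ, N, d]
        ring
    _ ≤ _ := by nlinarith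

lemma finDim_cml {n j : ℕ} {V : Type*} [NormedAddCommGroup V] [NormedSpace ℝ V]
    [FiniteDimensional ℝ V] : FiniteDimensional ℝ
      (ContinuousMultilinearMap ℝ (fun _ : Fin j => EuclideanSpace ℝ (Fin n)) V) :=
  FiniteDimensional.of_injective
    (ContinuousMultilinearMap.toMultilinearMapLinear : ContinuousMultilinearMap ℝ
      (fun _ : Fin j => EuclideanSpace ℝ (Fin n)) V →ₗ[ℝ] MultilinearMap ℝ
      (fun _ : Fin j => EuclideanSpace ℝ (Fin n)) V)
    ContinuousMultilinearMap.toMultilinearMap_injective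

lemma sobolev_iter {n : ℕ} {V : Type*} [NormedAddCommGroup V] [NormedSpace ℝ V]
    [FiniteDimensional ℝ V] (d ℓ : ℕ) (hd : 2 * d < n) :
    ∃ C : NNReal, ∀ (u : EuclideanSpace ℝ (Fin n) → V), ContDiff ℝ (⊤ : ℕ∞) u →
      HasCompactSupport u → ∀ q : NNReal, (q : ℝ)⁻¹ = 2⁻¹ - d * (n : ℝ)⁻¹ →
      eLpNorm (iteratedFDeriv ℝ ℓ u) q volume ≤
        C * eLpNorm (iteratedFDeriv ℝ (ℓ + d) u) 2 volume := by
  induction d generalizing ℓ with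
  | zero =>
    refine ⟨1, fun u _ _ q hq => ?_⟩
    have : q = 2 := by
      have : (q : ℝ) = 2 := by simpa using hq
      exact_mod_cast this
    simp [this]
  | succ d ih =>
    obtain ⟨C, hC⟩ := ih (ℓ + 1) (by omega)
    have hn : (0 : ℝ) < n := by
      have : 0 < n := by omega
      exact_mod_cast this
    have hdn : 2 * ((d : ℝ) + 1) < n := by exact_mod_cast hd
    have hpos : (0 : ℝ) < 2⁻¹ - d * (n : ℝ)⁻¹ := by
      rw [sub_pos, ← div_eq_mul_inv, div_lt_iff₀ hn]
      linarith
    let p : NNReal := ⟨(2⁻¹ - d * (n : ℝ)⁻¹)⁻¹, by positivity⟩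
    have hp : (p : ℝ)⁻¹ = 2⁻¹ - d * (n : ℝ)⁻¹ := inv_inv _
    have hp1 : 1 ≤ p := by
      have : (1 : ℝ) ≤ p := by
        change 1 ≤ (2⁻¹ - d * (n : ℝ)⁻¹)⁻¹
        rw [one_le_inv₀ hpos]
        have : 0 ≤ d * (n : ℝ)⁻¹ := by positivity
        linarith
      exact_mod_cast this
    have := finDim_cml (n := n) (j := ℓ) (V := V)
    refine ⟨SNormLESNormFDerivOfEqConst (ContinuousMultilinearMap ℝ
      (fun _ : Fin ℓ => EuclideanSpace ℝ (Fin n)) V)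
      (volume : Measure (EuclideanSpace ℝ (Fin n))) p * C, fun u hu hc q hq => ?_⟩
    have h1 := eLpNorm_le_eLpNorm_fderiv_of_eq (μ := volume) (u := iteratedFDeriv ℝ ℓ u)
      (hu.iteratedFDeriv_right (by exact_mod_cast le_top)) (hc.iteratedFDeriv ℓ)
      (p := p) (p' := q) hp1 (by simp; omega) (by
        rw [hq, NNReal.coe_inv, hp]
        simp
        ring)
    have h2 := hC u hu hc p hp
    have h3 : eLpNorm (fderiv ℝ (iteratedFDeriv ℝ ℓ u)) p volume =
        eLpNorm (iteratedFDeriv ℝ (ℓ + 1) u) p volume := by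
      have h4 : ∀ x, ‖fderiv ℝ (iteratedFDeriv ℝ ℓ u) x‖ = ‖iteratedFDeriv ℝ (ℓ + 1) u x‖ :=
        fun x => norm_fderiv_iteratedFDeriv
      rw [← eLpNorm_norm (fderiv ℝ (iteratedFDeriv ℝ ℓ u)),
        ← eLpNorm_norm (iteratedFDeriv ℝ (ℓ + 1) u)]
      simp only [h4]
    rw [h3] at h1
    refine h1.trans ?_
    rw [show ℓ + (d + 1) = ℓ + 1 + d by ring, ENNReal.coe_mul, mul_assoc]
    gcongr

/-- L² Sobolev estimate: for `A(D)` injectively elliptic of order `k`, `ℓ < k`,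
`n > 2(k-ℓ)`, one has `(∫ |D^ℓ u|^{2n/(n-2(k-ℓ))})^{1-2(k-ℓ)/n} ≤ C ∫ |A(D)u|²`. -/
theorem stmt1
    {V E : Type*} [NormedAddCommGroup V] [InnerProductSpace ℝ V] [FiniteDimensional ℝ V]
    [NormedAddCommGroup E] [InnerProductSpace ℝ E] [FiniteDimensional ℝ E]
    (n k ℓ : ℕ) (hn : 1 ≤ n) (hk : 1 ≤ k) (hl : ℓ < k) (hnkl : 2 * (k - ℓ) < n)
    (A : (Fin n → ℕ) → (V →ₗ[ℝ] E))
    (hell : ∀ ξ : EuclideanSpace ℝ (Fin n), ξ ≠ 0 → Function.Injective (symb k A ξ)) :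
    ∃ C : ℝ, 0 < C ∧ ∀ u : EuclideanSpace ℝ (Fin n) → V,
      ContDiff ℝ (⊤ : ℕ∞) u → HasCompactSupport u →
      (∫ x, ‖iteratedFDeriv ℝ ℓ u x‖ ^ ((2 * n : ℝ) / ((n : ℝ) - 2 * ((k - ℓ : ℕ) : ℝ))))
          ^ (1 - 2 * ((k - ℓ : ℕ) : ℝ) / (n : ℝ))
        ≤ C * ∫ x, ‖opApply k A u x‖ ^ 2 := by
  obtain ⟨C₁, hC₁, h1⟩ := L2_bound hk A hell
  obtain ⟨C₂, h2⟩ := sobolev_iter (n := n) (V := V) (k - ℓ) ℓ hnkl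
  refine ⟨((C₂ : ℝ) ^ 2 + 1) * C₁, by positivity, fun u hu hc => ?_⟩
  have hn0 : (0 : ℝ) < n := by exact_mod_cast hn
  have hd : 2 * ((k - ℓ : ℕ) : ℝ) < n := by exact_mod_cast hnkl
  set d : ℝ := ((k - ℓ : ℕ) : ℝ) with hd'
  have hnd : 0 < (n : ℝ) - 2 * d := by linarith
  let q : NNReal := ⟨(2 * n : ℝ) / ((n : ℝ) - 2 * d), by positivity⟩
  have hqv : (q : ℝ) = (2 * n : ℝ) / ((n : ℝ) - 2 * d) := rfl
  have hq0 : 0 < (q : ℝ) := by rw [hqv]; positivity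
  have h3 := h2 u hu hc q (by rw [hqv]; field_simp)
  rw [show ℓ + (k - ℓ) = k by omega] at h3
  have hm : ∀ (j : ℕ) (p : ENNReal), MemLp (iteratedFDeriv ℝ j u) p volume := fun j p =>
    (hu.continuous_iteratedFDeriv (by exact_mod_cast le_top)).memLp_of_hasCompactSupport
      (hc.iteratedFDeriv j)
  rw [(hm ℓ q).eLpNorm_eq_integral_rpow_norm (by exact_mod_cast hq0.ne') (by simp),
    (hm k 2).eLpNorm_eq_integral_rpow_norm (by simp) (by simp)] at h3
  simp only [ENNReal.coe_toReal, ENNReal.toReal_ofNat, Real.rpow_two] at h3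
  rw [← ENNReal.ofReal_coe_nnreal, ← ENNReal.ofReal_mul (by positivity),
    ENNReal.ofReal_le_ofReal_iff (by positivity)] at h3
  have h4 := h1 (hc.toSchwartzMap hu)
  change ∫ x, ‖iteratedFDeriv ℝ k u x‖ ^ 2 ≤ C₁ * ∫ x, ‖opApply k A u x‖ ^ 2 at h4
  rw [hqv] at h3
  set P := ∫ x, ‖iteratedFDeriv ℝ ℓ u x‖ ^ ((2 * n : ℝ) / ((n : ℝ) - 2 * d)) with hP
  have hP0 : 0 ≤ P := integral_nonneg fun x => by positivity
  set Q := ∫ x, ‖iteratedFDeriv ℝ k u x‖ ^ 2 with hQ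
  have hQ0 : 0 ≤ Q := integral_nonneg fun x => by positivity
  have e1 : P ^ (1 - 2 * d / (n : ℝ)) = (P ^ ((2 * n : ℝ) / ((n : ℝ) - 2 * d))⁻¹) ^ 2 := by
    rw [← Real.rpow_natCast, ← Real.rpow_mul hP0]
    congr 1
    push_cast
    field_simp
  have e2 : (Q ^ (2 : ℝ)⁻¹) ^ 2 = Q := by
    rw [← Real.rpow_natCast, ← Real.rpow_mul hQ0]
    norm_num
  rw [e1]
  calc (P ^ ((2 * n : ℝ) / ((n : ℝ) - 2 * d))⁻¹) ^ 2 ≤ (C₂ * Q ^ (2 : ℝ)⁻¹) ^ 2 := by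
        gcongr
    _ = (C₂ : ℝ) ^ 2 * Q := by rw [mul_pow, e2]
    _ ≤ ((C₂ : ℝ) ^ 2 + 1) * Q := by gcongr; linarith
    _ ≤ ((C₂ : ℝ) ^ 2 + 1) * (C₁ * ∫ x, ‖opApply k A u x‖ ^ 2) := by gcongr
    _ = _ := by ring

end
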